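/- arXiv:1804.10834 — 4 statements merged into one kernel-verified Lean document; each statement's English description precedes it below -/
import Mathlib

section
/- Let A_s and A_t be n×n real symmetric positive definite matrices. The function ω(A) = tr(A·A_s) + tr(A⁻¹·A_t), defined on the set of n×n real symmetric positive definite matrices, is strictly convex: for all symmetric positive definite matrices A ≠ B and all t ∈ (0,1), ω((1−t)·A + t·B) < (1−t)·ω(A) + t·ω(B). -/
namespace Matrix

variable {ι : Type*} [Fintype ι] [DecidableEq ι] {A B C S X : Matrix ι ι ℝ}

open scoped MatrixOrder in
theorem PosDef.exists_isUnit_eq_transpose_mul_self (hA : A.PosDef) :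
    ∃ G : Matrix ι ι ℝ, IsUnit G ∧ A = Gᵀ * G := by
  obtain ⟨G, hG⟩ := CStarAlgebra.nonneg_iff_eq_star_mul_self.mp hA.posSemidef.nonneg
  rw [star_eq_conjTranspose, conjTranspose_eq_transpose_of_trivial] at hG
  exact ⟨G, isUnit_of_mul_isUnit_right (hG ▸ hA.isUnit), hG⟩

theorem PosDef.trace_mul_mul_mul_pos (hA : A.PosDef) (hS : S.PosDef) (hX : X.IsSymm)
    (hX₀ : X ≠ 0) : 0 < (X * A * X * S).trace := by
  obtain ⟨G, hG, rfl⟩ := hA.exists_isUnit_eq_transpose_mul_self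
  obtain ⟨H, hH, rfl⟩ := hS.exists_isUnit_eq_transpose_mul_self
  have htrace : (X * (Gᵀ * G) * X * (Hᵀ * H)).trace = ((G * X * Hᵀ)ᴴ * (G * X * Hᵀ)).trace := by
    rw [← Matrix.mul_assoc _ Hᵀ H, trace_mul_comm]
    simp only [conjTranspose_eq_transpose_of_trivial, transpose_mul, transpose_transpose, hX.eq,
      Matrix.mul_assoc]
  rw [htrace]
  refine (posSemidef_conjTranspose_mul_self _).trace_nonneg.lt_of_ne' fun h => hX₀ ?_
  rw [trace_conjTranspose_mul_self_eq_zero_iff] at h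
  have hHt : IsUnit Hᵀ := (isUnit_transpose H).mpr hH
  exact hG.mul_right_eq_zero.mp (hHt.mul_left_eq_zero.mp h)

theorem inv_sub_inv_mul_mul_inv_sub_inv (hA : IsUnit A) :
    (A⁻¹ - C⁻¹) * A * (A⁻¹ - C⁻¹) = A⁻¹ - 2 • C⁻¹ + C⁻¹ * A * C⁻¹ := by
  have hdet := (isUnit_iff_isUnit_det A).mp hA
  rw [sub_mul, nonsing_inv_mul _ hdet, sub_mul, one_mul, mul_sub, mul_assoc C⁻¹ A A⁻¹,
    mul_nonsing_inv _ hdet, mul_one, two_smul]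
  abel

/-- The tangent-line inequality for `A ↦ tr (A⁻¹ * S)` at `C`. -/
theorem PosDef.two_mul_trace_inv_mul_lt (hA : A.PosDef) (hC : C.PosDef) (hS : S.PosDef)
    (hAC : A ≠ C) :
    2 * (C⁻¹ * S).trace < (A⁻¹ * S).trace + (C⁻¹ * A * C⁻¹ * S).trace := by
  have hsymm : (A⁻¹ - C⁻¹).IsSymm := by
    simpa only [IsHermitian, IsSymm, conjTranspose_eq_transpose_of_trivial] using
      hA.inv.isHermitian.sub hC.inv.isHermitian
  have hne : A⁻¹ - C⁻¹ ≠ 0 := fun h => hAC <|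
    inv_inj (sub_eq_zero.mp h) ((isUnit_iff_isUnit_det A).mp hA.isUnit)
  have hpos := hA.trace_mul_mul_mul_pos hS hsymm hne
  rw [inv_sub_inv_mul_mul_inv_sub_inv hA.isUnit, add_mul, sub_mul, smul_mul_assoc, trace_add,
    trace_sub, trace_smul, nsmul_eq_mul, Nat.cast_ofNat] at hpos
  linarith

theorem PosDef.trace_inv_mul_lt (hA : A.PosDef) (hB : B.PosDef) (hS : S.PosDef) (hAB : A ≠ B)
    {t : ℝ} (ht₀ : 0 < t) (ht₁ : t < 1) :
    (((1 - t) • A + t • B)⁻¹ * S).trace <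
      (1 - t) * (A⁻¹ * S).trace + t * (B⁻¹ * S).trace := by
  have hs : 0 < 1 - t := sub_pos.mpr ht₁
  set C := (1 - t) • A + t • B with hCdef
  have hC : C.PosDef := (hA.smul hs).add (hB.smul ht₀)
  have hAC : A ≠ C := by
    intro h
    have h' : t • (A - B) = 0 := by
      rw [← sub_eq_zero.mpr h, hCdef]
      module
    exact hAB (sub_eq_zero.mp ((smul_eq_zero.mp h').resolve_left ht₀.ne'))
  have hBC : B ≠ C := by
    intro h
    have h' : (1 - t) • (B - A) = 0 := by
      rw [← sub_eq_zero.mpr h, hCdef]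
      module
    exact hAB (sub_eq_zero.mp ((smul_eq_zero.mp h').resolve_left hs.ne')).symm
  have hA' := mul_lt_mul_of_pos_left (hA.two_mul_trace_inv_mul_lt hC hS hAC) hs
  have hB' := mul_lt_mul_of_pos_left (hB.two_mul_trace_inv_mul_lt hC hS hBC) ht₀
  have hcomb : (1 - t) * (C⁻¹ * A * C⁻¹ * S).trace + t * (C⁻¹ * B * C⁻¹ * S).trace =
      (C⁻¹ * S).trace := by
    calc
      _ = (C⁻¹ * C * C⁻¹ * S).trace := by
        nth_rw 6 [hCdef]
        simp only [mul_add, add_mul, mul_smul_comm, smul_mul_assoc, trace_add, trace_smul,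
          smul_eq_mul]
      _ = _ := by rw [nonsing_inv_mul _ ((isUnit_iff_isUnit_det C).mp hC.isUnit), one_mul]
  linarith

end Matrix


open Matrix

/-- For fixed symmetric positive definite matrices `As` and `At`, the function
`ω(A) = tr(A·As) + tr(A⁻¹·At)` is strictly convex on the set of symmetric positive definite
matrices: for all PD matrices `A ≠ B` and all `t ∈ (0,1)`,
`ω((1−t)·A + t·B) < (1−t)·ω(A) + t·ω(B)`. -/
theorem omega_strictConvexOn_posDef {n : ℕ} (As At : Matrix (Fin n) (Fin n) ℝ)
    (hAs : As.PosDef) (hAt : At.PosDef)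
    (ω : Matrix (Fin n) (Fin n) ℝ → ℝ)
    (hω : ∀ A : Matrix (Fin n) (Fin n) ℝ, ω A = (A * As).trace + (A⁻¹ * At).trace) :
    ∀ A B : Matrix (Fin n) (Fin n) ℝ, A.PosDef → B.PosDef → A ≠ B →
      ∀ t : ℝ, 0 < t → t < 1 →
        ω ((1 - t) • A + t • B) < (1 - t) * ω A + t * ω B := by
  intro A B hA hB hAB t ht₀ ht₁
  have hinv := hA.trace_inv_mul_lt hB hAt hAB ht₀ ht₁
  simp only [hω, add_mul ((1 - t) • A), smul_mul_assoc, trace_add, trace_smul, smul_eq_mul]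
  linarith
end

section
/- Let A_s and A_t be n×n real symmetric positive definite matrices, let A be a symmetric positive definite matrix, and let H be any symmetric matrix. Then the directional derivative at s = 0 of s ↦ tr((A + s·H)·A_s) + tr((A + s·H)⁻¹·A_t) equals tr(H·A_s) − tr(A⁻¹·H·A⁻¹·A_t). Moreover, this directional derivative vanishes for every symmetric H if and only if A·A_s·A = A_t. -/
open Matrix

open scoped Matrix.Norms.Operator in
/-- The derivative of `s ↦ tr((A + s·H)·P) + tr((A + s·H)⁻¹·Q)` at `0`, for invertible `A`. -/
theorem hasDerivAt_trace_mul_add_trace_inv_mul {m : Type*} [Fintype m] [DecidableEq m]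
    {A : Matrix m m ℝ} (hA : IsUnit A) (H P Q : Matrix m m ℝ) :
    HasDerivAt (fun s : ℝ => ((A + s • H) * P).trace + ((A + s • H)⁻¹ * Q).trace)
      ((H * P).trace - (A⁻¹ * H * A⁻¹ * Q).trace) 0 := by
  have hline : HasDerivAt (fun s : ℝ => A + s • H) H 0 := by
    have h := (hasDerivAt_id (0 : ℝ)).smul_const H
    rw [one_smul] at h
    exact h.const_add A
  have hinv : HasDerivAt (fun s : ℝ => (A + s • H)⁻¹) (-(A⁻¹ * H * A⁻¹)) 0 := by
    obtain ⟨u, rfl⟩ := hA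
    have h := (hasFDerivAt_ringInverse (𝕜 := ℝ) u).comp_hasDerivAt_of_eq (0 : ℝ) hline (by simp)
    simp only [nonsing_inv_eq_ringInverse, Ring.inverse_unit]
    exact h
  have htrace (M : Matrix m m ℝ) {f : ℝ → Matrix m m ℝ} {f' : Matrix m m ℝ}
      (hf : HasDerivAt f f' 0) :
      HasDerivAt (fun s => (f s * M).trace) (f' * M).trace 0 :=
    (traceLinearMap m ℝ ℝ).toContinuousLinearMap.hasFDerivAt.comp_hasDerivAt (0 : ℝ)
      (hf.mul_const M)
  rw [sub_eq_add_neg, ← trace_neg, ← neg_mul]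
  exact (htrace P hline).add (htrace Q hinv)

/-- The trace form is nondegenerate on real symmetric matrices. -/
theorem Matrix.IsSymm.eq_zero_of_forall_trace_mul_eq_zero {m : Type*} [Fintype m]
    {G : Matrix m m ℝ} (hG : G.IsSymm)
    (h : ∀ H : Matrix m m ℝ, H.IsSymm → (H * G).trace = 0) : G = 0 := by
  rw [← trace_conjTranspose_mul_self_eq_zero_iff, conjTranspose_eq_transpose_of_trivial, hG.eq]
  exact h G hG

/-- For symmetric positive definite matrices `As`, `At`, a symmetric positive
definite matrix `A`, and any symmetric matrix `H`, the directional derivative at `s = 0` of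
`s ↦ tr((A + s·H)·As) + tr((A + s·H)⁻¹·At)` equals `tr(H·As) − tr(A⁻¹·H·A⁻¹·At)`.
Moreover, this directional derivative vanishes for every symmetric `H` if and only if
`A·As·A = At`. -/
theorem omega_directional_derivative {n : ℕ} (As At : Matrix (Fin n) (Fin n) ℝ)
    (hAs : As.PosDef) (hAt : At.PosDef)
    (A : Matrix (Fin n) (Fin n) ℝ) (hA : A.PosDef) :
    (∀ H : Matrix (Fin n) (Fin n) ℝ, H.IsSymm →
      HasDerivAt (fun s : ℝ => ((A + s • H) * As).trace + ((A + s • H)⁻¹ * At).trace)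
        ((H * As).trace - (A⁻¹ * H * A⁻¹ * At).trace) 0) ∧
    ((∀ H : Matrix (Fin n) (Fin n) ℝ, H.IsSymm →
        (H * As).trace - (A⁻¹ * H * A⁻¹ * At).trace = 0) ↔ A * As * A = At) := by
  have hAu : IsUnit A := hA.isUnit
  have hdet : IsUnit A.det := (isUnit_iff_isUnit_det A).mp hAu
  refine ⟨fun H _ => hasDerivAt_trace_mul_add_trace_inv_mul hAu H As At, ?_⟩
  have hgrad (H : Matrix (Fin n) (Fin n) ℝ) :
      (H * As).trace - (A⁻¹ * H * A⁻¹ * At).trace = (H * (As - A⁻¹ * At * A⁻¹)).trace := by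
    rw [mul_sub, trace_sub, mul_assoc, mul_assoc A⁻¹, trace_mul_comm A⁻¹]
    simp only [mul_assoc]
  have hstat : A * As * A = At ↔ As - A⁻¹ * At * A⁻¹ = 0 := by
    rw [sub_eq_zero]
    constructor
    · rintro rfl
      rw [mul_assoc A, nonsing_inv_mul_cancel_left _ _ hdet, mul_nonsing_inv_cancel_right _ _ hdet]
    · intro h
      rw [h, mul_assoc A⁻¹, mul_nonsing_inv_cancel_left _ _ hdet,
        nonsing_inv_mul_cancel_right _ _ hdet]
  have hsymm : (As - A⁻¹ * At * A⁻¹).IsSymm := by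
    have hs {M : Matrix (Fin n) (Fin n) ℝ} (hM : M.PosDef) : Mᵀ = M := by
      simpa using hM.isHermitian.eq
    simp [IsSymm, transpose_nonsing_inv, hs hAs, hs hAt, hs hA, mul_assoc]
  simp only [hgrad, hstat]
  exact ⟨hsymm.eq_zero_of_forall_trace_mul_eq_zero, fun h H _ => by simp [h]⟩
end

section
/- Let A_s and A_t be n×n real symmetric positive definite matrices with eigenvalue decompositions A_s = U_s Σ_s U_sᵀ and A_t = U_t Σ_t U_tᵀ, where U_s, U_t are orthogonal and Σ_s, Σ_t are diagonal with positive entries. Then for every orthogonal matrix O, the matrix A = U_s Σ_s^{-1/2} U_sᵀ O U_t Σ_t^{1/2} U_tᵀ satisfies Aᵀ A_s A = A_t; consequently every such A is a global minimizer of the CORAL objective F(A) = ‖Aᵀ A_s A − A_t‖_F² (achieving the value 0), so the CORAL minimizer is not unique. -/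
open Matrix

/-- The CORAL closed-form solution `Us Σs^{-1/2} Usᵀ O Ut Σt^{1/2} Utᵀ` associated with the
eigenvector matrices `Us`, `Ut`, eigenvalue vectors `ds`, `dt`, and an orthogonal matrix `O`. -/
noncomputable def coralSol {n : ℕ} (Us Ut : Matrix (Fin n) (Fin n) ℝ) (ds dt : Fin n → ℝ)
    (O : Matrix (Fin n) (Fin n) ℝ) : Matrix (Fin n) (Fin n) ℝ :=
  Us * Matrix.diagonal (fun i => ds i ^ (-(1 / 2) : ℝ)) * Usᵀ * O * Ut *
    Matrix.diagonal (fun i => dt i ^ ((1 / 2) : ℝ)) * Utᵀ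

theorem transpose_conj_diagonal {n : ℕ} (U : Matrix (Fin n) (Fin n) ℝ) (d : Fin n → ℝ) :
    (U * Matrix.diagonal d * Uᵀ)ᵀ = U * Matrix.diagonal d * Uᵀ := by
  simp [Matrix.transpose_mul, Matrix.mul_assoc]

theorem conj_diagonal_mul_conj_diagonal {n : ℕ} {U : Matrix (Fin n) (Fin n) ℝ}
    (hU : Uᵀ * U = 1) (d e : Fin n → ℝ) :
    (U * Matrix.diagonal d * Uᵀ) * (U * Matrix.diagonal e * Uᵀ) =
      U * Matrix.diagonal (fun i => d i * e i) * Uᵀ := by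
  calc _ = U * Matrix.diagonal d * (Uᵀ * U) * Matrix.diagonal e * Uᵀ := by
        simp only [Matrix.mul_assoc]
    _ = _ := by
        rw [hU, Matrix.mul_one, Matrix.mul_assoc U, Matrix.diagonal_mul_diagonal]

/-- `coralSol` pulls the source matrix back to the target matrix. -/
theorem coralSol_transpose_mul_mul {n : ℕ} {Us Ut O : Matrix (Fin n) (Fin n) ℝ}
    {ds dt : Fin n → ℝ} (hUs : Us * Usᵀ = 1) (hUs' : Usᵀ * Us = 1) (hUt' : Utᵀ * Ut = 1)
    (hds : ∀ i, 0 < ds i) (hdt : ∀ i, 0 < dt i) (hO : Oᵀ * O = 1) :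
    (coralSol Us Ut ds dt O)ᵀ * (Us * Matrix.diagonal ds * Usᵀ) * coralSol Us Ut ds dt O =
      Ut * Matrix.diagonal dt * Utᵀ := by
  set P := Us * Matrix.diagonal (fun i => ds i ^ (-(1 / 2) : ℝ)) * Usᵀ with hP
  set Q := Ut * Matrix.diagonal (fun i => dt i ^ ((1 / 2) : ℝ)) * Utᵀ with hQ
  set S := Us * Matrix.diagonal ds * Usᵀ with hS
  have hsol : coralSol Us Ut ds dt O = P * O * Q := by
    simp only [coralSol, hP, hQ, Matrix.mul_assoc]
  have hPT : Pᵀ = P := transpose_conj_diagonal _ _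
  have hQT : Qᵀ = Q := transpose_conj_diagonal _ _
  have hPSP : P * S * P = 1 := by
    have h : (fun i => ds i ^ (-(1 / 2) : ℝ) * ds i * ds i ^ (-(1 / 2) : ℝ)) = fun _ => 1 := by
      funext i
      rw [mul_right_comm, ← Real.rpow_add (hds i), ← Real.rpow_add_one (hds i).ne']
      norm_num
    rw [hP, hS, conj_diagonal_mul_conj_diagonal hUs', conj_diagonal_mul_conj_diagonal hUs', h,
      Matrix.diagonal_one, Matrix.mul_one, hUs]
  have hQQ : Q * Q = Ut * Matrix.diagonal dt * Utᵀ := by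
    have h : (fun i => dt i ^ ((1 / 2) : ℝ) * dt i ^ ((1 / 2) : ℝ)) = dt := by
      funext i
      rw [← Real.rpow_add (hdt i)]
      norm_num
    rw [hQ, conj_diagonal_mul_conj_diagonal hUt', h]
  calc _ = Q * Oᵀ * (P * S * P) * O * Q := by
        simp only [hsol, Matrix.transpose_mul, hPT, hQT, Matrix.mul_assoc]
    _ = Q * (Oᵀ * O) * Q := by simp only [hPSP, Matrix.mul_one, Matrix.mul_assoc]
    _ = _ := by rw [hO, Matrix.mul_one, hQQ]

/-- Let `As`, `At` be symmetric positive definite with eigenvalue decompositions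
`As = Us Σs Usᵀ`, `At = Ut Σt Utᵀ` (`Us`, `Ut` orthogonal, `Σs = diagonal ds`,
`Σt = diagonal dt` with positive entries). Then for every orthogonal `O`, the matrix
`A = Us Σs^{-1/2} Usᵀ O Ut Σt^{1/2} Utᵀ` satisfies `Aᵀ As A = At`; consequently every such `A`
is a global minimizer of the CORAL objective `F(A) = ‖Aᵀ As A − At‖_F²` (achieving the value
`0`), so the CORAL minimizer is not unique (for `n ≥ 1`). -/
theorem coral_minimizer_not_unique {n : ℕ} (hn : 0 < n)
    (As At Us Ut : Matrix (Fin n) (Fin n) ℝ) (ds dt : Fin n → ℝ)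
    (hAsPD : As.PosDef) (hAtPD : At.PosDef)
    (hUs : Us * Usᵀ = 1) (hUs' : Usᵀ * Us = 1)
    (hUt : Ut * Utᵀ = 1) (hUt' : Utᵀ * Ut = 1)
    (hds : ∀ i, 0 < ds i) (hdt : ∀ i, 0 < dt i)
    (hAs : As = Us * Matrix.diagonal ds * Usᵀ)
    (hAt : At = Ut * Matrix.diagonal dt * Utᵀ)
    (F : Matrix (Fin n) (Fin n) ℝ → ℝ)
    (hF : ∀ B : Matrix (Fin n) (Fin n) ℝ,
      F B = ∑ i : Fin n, ∑ j : Fin n, ((Bᵀ * As * B - At) i j) ^ 2) :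
    (∀ O : Matrix (Fin n) (Fin n) ℝ, O * Oᵀ = 1 → Oᵀ * O = 1 →
      (coralSol Us Ut ds dt O)ᵀ * As * coralSol Us Ut ds dt O = At ∧
      F (coralSol Us Ut ds dt O) = 0 ∧
      ∀ B : Matrix (Fin n) (Fin n) ℝ, F (coralSol Us Ut ds dt O) ≤ F B) ∧
    (∃ A₁ A₂ : Matrix (Fin n) (Fin n) ℝ, A₁ ≠ A₂ ∧
      A₁ᵀ * As * A₁ = At ∧ A₂ᵀ * As * A₂ = At ∧
      (∀ B : Matrix (Fin n) (Fin n) ℝ, F A₁ ≤ F B) ∧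
      (∀ B : Matrix (Fin n) (Fin n) ℝ, F A₂ ≤ F B)) := by
  have key : ∀ O : Matrix (Fin n) (Fin n) ℝ, Oᵀ * O = 1 →
      (coralSol Us Ut ds dt O)ᵀ * As * coralSol Us Ut ds dt O = At := by
    intro O hO
    rw [hAs, hAt]
    exact coralSol_transpose_mul_mul hUs hUs' hUt' hds hdt hO
  have hzero : ∀ A : Matrix (Fin n) (Fin n) ℝ, Aᵀ * As * A = At → F A = 0 := by
    intro A hA
    simp [hF, hA]
  have hmin : ∀ A : Matrix (Fin n) (Fin n) ℝ, Aᵀ * As * A = At → ∀ B, F A ≤ F B := by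
    intro A hA B
    rw [hzero A hA, hF B]
    positivity
  refine ⟨fun O _ hO => ⟨key O hO, hzero _ (key O hO), hmin _ (key O hO)⟩, ?_⟩
  have h₁ := key 1 (by simp)
  set A := coralSol Us Ut ds dt 1
  have h₂ : (-A)ᵀ * As * (-A) = At := by simpa using h₁
  refine ⟨A, -A, fun h => ?_, h₁, h₂, hmin _ h₁, hmin _ h₂⟩
  have hA : A = 0 := by
    ext i j
    have hij := congrFun (congrFun h i) j
    simp only [Matrix.neg_apply] at hij
    simp only [Matrix.zero_apply]
    linarith
  have hpos := hAtPD.diag_pos (i := ⟨0, hn⟩)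
  rw [← h₁, hA] at hpos
  simp at hpos
end

section
/- Let A, B, C be n×n real symmetric positive definite matrices with A ≠ B, and let t ∈ (0,1). Then matrix inversion is strictly trace-convex against the positive definite weight C: tr(((1−t)·A + t·B)⁻¹ · C) < (1−t)·tr(A⁻¹·C) + t·tr(B⁻¹·C). -/
open Matrix

open scoped MatrixOrder in
lemma Matrix.PosDef.exists_isUnit_conjTranspose_mul_self {m : Type*} [Fintype m] [DecidableEq m]
    {P : Matrix m m ℝ} (hP : P.PosDef) : ∃ S : Matrix m m ℝ, IsUnit S ∧ P = Sᴴ * S :=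
  CStarAlgebra.isStrictlyPositive_iff_eq_star_mul_self.mp hP.isStrictlyPositive

/-- The quadratic form `X ↦ tr (Xᴴ P X C)` is positive definite for positive definite `P`, `C`. -/
lemma Matrix.PosDef.trace_conjTranspose_mul_mul_mul_nonneg_and_eq_zero_iff
    {m : Type*} [Fintype m] [DecidableEq m] {P C : Matrix m m ℝ} (hP : P.PosDef) (hC : C.PosDef)
    (X : Matrix m m ℝ) :
    0 ≤ (Xᴴ * P * X * C).trace ∧ ((Xᴴ * P * X * C).trace = 0 ↔ X = 0) := by
  obtain ⟨S, hS, rfl⟩ := hP.exists_isUnit_conjTranspose_mul_self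
  obtain ⟨R, hR, rfl⟩ := hC.exists_isUnit_conjTranspose_mul_self
  have key : (Xᴴ * (Sᴴ * S) * X * (Rᴴ * R)).trace = ((S * X * Rᴴ)ᴴ * (S * X * Rᴴ)).trace := by
    rw [← Matrix.mul_assoc _ Rᴴ R, trace_mul_comm]
    simp [Matrix.mul_assoc]
  rw [key, trace_conjTranspose_mul_self_eq_zero_iff]
  refine ⟨(posSemidef_conjTranspose_mul_self _).trace_nonneg, ?_⟩
  have hR' : IsUnit Rᴴ := hR.star
  rw [hR'.mul_left_eq_zero, hS.mul_right_eq_zero]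

/-- The convexity gap of matrix inversion, as a weighted sum of squares. -/
lemma Matrix.inv_convexity_gap {m : Type*} [Fintype m] [DecidableEq m] {A B M : Matrix m m ℝ}
    {t : ℝ} (hA : IsUnit A.det) (hB : IsUnit B.det) (hM : IsUnit M.det)
    (h : M = (1 - t) • A + t • B) :
    (1 - t) • A⁻¹ + t • B⁻¹ - M⁻¹ =
      (1 - t) • ((A⁻¹ - M⁻¹) * A * (A⁻¹ - M⁻¹)) + t • ((B⁻¹ - M⁻¹) * B * (B⁻¹ - M⁻¹)) := by
  have expand : ∀ D : Matrix m m ℝ, IsUnit D.det →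
      (D⁻¹ - M⁻¹) * D * (D⁻¹ - M⁻¹) = D⁻¹ - M⁻¹ - M⁻¹ + M⁻¹ * D * M⁻¹ := by
    intro D hD
    simp only [sub_mul, mul_sub, nonsing_inv_mul D hD, one_mul, mul_nonsing_inv_cancel_right _ _ hD]
    abel
  have mid : (1 - t) • (M⁻¹ * A * M⁻¹) + t • (M⁻¹ * B * M⁻¹) = M⁻¹ := by
    calc _ = M⁻¹ * ((1 - t) • A + t • B) * M⁻¹ := by
          simp only [mul_add, add_mul, mul_smul_comm, smul_mul_assoc]
      _ = M⁻¹ := by rw [← h, nonsing_inv_mul M hM, one_mul]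
  rw [expand A hA, expand B hB]
  calc _ = (1 - t) • (A⁻¹ - M⁻¹ - M⁻¹) + t • (B⁻¹ - M⁻¹ - M⁻¹) + M⁻¹ := by module
    _ = (1 - t) • (A⁻¹ - M⁻¹ - M⁻¹) + t • (B⁻¹ - M⁻¹ - M⁻¹) +
        ((1 - t) • (M⁻¹ * A * M⁻¹) + t • (M⁻¹ * B * M⁻¹)) := by rw [mid]
    _ = _ := by module

/-- For symmetric positive definite matrices `A`, `B`, `C` with `A ≠ B` and
`t ∈ (0,1)`, matrix inversion is strictly trace-convex against the positive definite weight
`C`: `tr(((1−t)·A + t·B)⁻¹ · C) < (1−t)·tr(A⁻¹·C) + t·tr(B⁻¹·C)`. -/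
theorem inv_strict_trace_convex {n : ℕ} (A B C : Matrix (Fin n) (Fin n) ℝ)
    (hA : A.PosDef) (hB : B.PosDef) (hC : C.PosDef) (hAB : A ≠ B)
    (t : ℝ) (ht0 : 0 < t) (ht1 : t < 1) :
    (((1 - t) • A + t • B)⁻¹ * C).trace <
      (1 - t) * (A⁻¹ * C).trace + t * (B⁻¹ * C).trace := by
  have ht : 0 < 1 - t := sub_pos.mpr ht1
  have hM : ((1 - t) • A + t • B).PosDef := (hA.smul ht).add (hB.smul ht0)
  obtain ⟨M, hM_eq⟩ : ∃ M, M = (1 - t) • A + t • B := ⟨_, rfl⟩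
  rw [← hM_eq] at hM ⊢
  have det {D : Matrix (Fin n) (Fin n) ℝ} (hD : D.PosDef) : IsUnit D.det :=
    (Matrix.isUnit_iff_isUnit_det D).mp hD.isUnit
  have gap := congrArg (fun Z => (Z * C).trace)
    (Matrix.inv_convexity_gap (det hA) (det hB) (det hM) hM_eq)
  simp only [sub_mul _ _ C, add_mul, smul_mul_assoc, trace_sub, trace_add, trace_smul,
    smul_eq_mul] at gap
  have hX := hA.trace_conjTranspose_mul_mul_mul_nonneg_and_eq_zero_iff hC (A⁻¹ - M⁻¹)
  have hY := hB.trace_conjTranspose_mul_mul_mul_nonneg_and_eq_zero_iff hC (B⁻¹ - M⁻¹)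
  rw [(hA.inv.isHermitian.sub hM.inv.isHermitian).eq] at hX
  rw [(hB.inv.isHermitian.sub hM.inv.isHermitian).eq] at hY
  have hne : A⁻¹ - M⁻¹ ≠ 0 ∨ B⁻¹ - M⁻¹ ≠ 0 := by
    by_contra! h
    exact hAB (inv_inj ((sub_eq_zero.mp h.1).trans (sub_eq_zero.mp h.2).symm) (det hA))
  rcases hne with h | h
  · have := mul_pos ht (hX.1.lt_of_ne' (mt hX.2.mp h))
    have := mul_nonneg ht0.le hY.1
    linarith
  · have := mul_nonneg ht.le hX.1
    have := mul_pos ht0 (hY.1.lt_of_ne' (mt hY.2.mp h))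
    linarith
end
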